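/- arXiv:1004.1477 — 2 statements merged into one kernel-verified Lean document; each statement's English description precedes it below -/
import Mathlib

section
/- Let w₁, w₂, w₃ be any odd positive integers and let n ∈ ℕ. Then ∑_{k+l+m=n} (n choose k,l,m) T_{k,q^{w₃}}(w₁−1) T_{l,q^{w₁}}(w₂−1) T_{m,q^{w₂}}(w₃−1) w₃^{k} w₁^{l} w₂^{m} = ∑_{k+l+m=n} (n choose k,l,m) T_{k,q^{w₂}}(w₁−1) T_{l,q^{w₁}}(w₃−1) T_{m,q^{w₃}}(w₂−1) w₂^{k} w₁^{l} w₃^{m}. -/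
/-- `T_{k,r}(n) = ∑_{i=0}^{n} (-1)^i i^k r^i`, the q-analogue of the
alternating k-th power sum. -/
def altPowSum {R : Type*} [Ring R] (r : R) (k n : ℕ) : R :=
  ∑ i ∈ Finset.range (n + 1), (-1 : R) ^ i * (i : R) ^ k * r ^ i

open Polynomial in
/-- The functional `X^N ↦ q^N N^n`. -/
noncomputable def altPhi {R : Type*} [CommRing R] (q : R) (n : ℕ) : ℤ[X] →ₗ[ℤ] R :=
  Polynomial.lsum (fun N => LinearMap.toSpanSingleton ℤ R (q ^ N * (N : R) ^ n))

open Polynomial in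
theorem altPhi_term {R : Type*} [CommRing R] (q : R) (n N j : ℕ) :
    altPhi q n ((-1) ^ j * X ^ N) = (-1) ^ j * (q ^ N * (N : R) ^ n) := by
  have h : ((-1 : ℤ[X]) ^ j * X ^ N) = monomial N ((-1 : ℤ) ^ j) := by
    rw [← C_mul_X_pow_eq_monomial]; simp
  rw [h, altPhi, Polynomial.lsum_apply, Polynomial.sum_monomial_index]
  · simp [LinearMap.toSpanSingleton_apply, zsmul_eq_mul]
  · simp

theorem alt_trinomial {R : Type*} [CommRing R] (x y z : R) (n : ℕ) :
    (x + y + z) ^ n = ∑ k ∈ Finset.range (n + 1), ∑ l ∈ Finset.range (n + 1 - k),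
      (n.choose k : R) * ((n - k).choose l : R) * x ^ k * y ^ l * z ^ (n - k - l) := by
  rw [add_assoc, add_pow]
  refine Finset.sum_congr rfl fun k hk => ?_
  have hk' : k ≤ n := by simpa [Nat.lt_succ_iff] using hk
  rw [add_pow, Finset.mul_sum, Finset.sum_mul, Nat.sub_add_comm hk']
  refine Finset.sum_congr rfl fun l _ => ?_
  ring

open Polynomial in
noncomputable def altPoly (α A : ℕ) : ℤ[X] := ∑ a ∈ Finset.range A, (-1) ^ a * X ^ (α * a)

open Polynomial in
theorem altPoly_mul (α A : ℕ) (hA : Odd A) :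
    (1 + X ^ α) * altPoly α A = 1 + X ^ (α * A) := by
  have h := mul_neg_geom_sum (-(X : ℤ[X]) ^ α) A
  rw [hA.neg_pow, ← pow_mul, sub_neg_eq_add, sub_neg_eq_add] at h
  rw [← h, altPoly]
  congr 1
  refine Finset.sum_congr rfl fun a _ => ?_
  rw [neg_pow (X ^ α : ℤ[X]), pow_mul]

theorem alt_prod3 {R : Type*} [CommRing R] (f g h : ℕ → R) (A B C : ℕ) :
    (∑ a ∈ Finset.range A, f a) * (∑ b ∈ Finset.range B, g b) * (∑ c ∈ Finset.range C, h c) =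
      ∑ a ∈ Finset.range A, ∑ b ∈ Finset.range B, ∑ c ∈ Finset.range C, f a * g b * h c := by
  rw [Finset.sum_mul_sum, Finset.sum_mul]
  refine Finset.sum_congr rfl fun a _ => ?_
  rw [Finset.sum_mul_sum]

theorem alt_expand {R : Type*} [CommRing R] (q : R) (n α β γ A B C : ℕ)
    (hA : 0 < A) (hB : 0 < B) (hC : 0 < C) :
    ∑ k ∈ Finset.range (n + 1), ∑ l ∈ Finset.range (n + 1 - k),
        (n.choose k : R) * ((n - k).choose l : R) *
          altPowSum (q ^ α) k (A - 1) * altPowSum (q ^ β) l (B - 1) *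
          altPowSum (q ^ γ) (n - k - l) (C - 1) *
          (α : R) ^ k * (β : R) ^ l * (γ : R) ^ (n - k - l)
      = altPhi q n (altPoly α A * altPoly β B * altPoly γ C) := by
  have e : altPoly α A * altPoly β B * altPoly γ C =
      ∑ a ∈ Finset.range A, ∑ b ∈ Finset.range B, ∑ c ∈ Finset.range C,
        (-1) ^ (a + b + c) * Polynomial.X ^ (α * a + β * b + γ * c) := by
    rw [altPoly, altPoly, altPoly, alt_prod3]
    refine Finset.sum_congr rfl fun a _ => Finset.sum_congr rfl fun b _ =>
      Finset.sum_congr rfl fun c _ => ?_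
    ring
  rw [e]
  simp only [map_sum, altPhi_term, altPowSum, Nat.sub_add_cancel hA, Nat.sub_add_cancel hB,
    Nat.sub_add_cancel hC]
  push_cast
  conv_rhs => simp only [alt_trinomial, Finset.mul_sum]
  have sw : ∀ f : ℕ → ℕ → ℕ → ℕ → ℕ → R,
      ∑ a ∈ Finset.range A, ∑ b ∈ Finset.range B, ∑ c ∈ Finset.range C,
        ∑ k ∈ Finset.range (n + 1), ∑ l ∈ Finset.range (n + 1 - k), f a b c k l =
      ∑ k ∈ Finset.range (n + 1), ∑ l ∈ Finset.range (n + 1 - k),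
        ∑ a ∈ Finset.range A, ∑ b ∈ Finset.range B, ∑ c ∈ Finset.range C, f a b c k l := by
    intro f
    have s1 : ∀ g : ℕ → ℕ → ℕ → R, ∀ S : Finset ℕ,
        ∑ a ∈ S, ∑ k ∈ Finset.range (n + 1), ∑ l ∈ Finset.range (n + 1 - k), g a k l =
        ∑ k ∈ Finset.range (n + 1), ∑ l ∈ Finset.range (n + 1 - k), ∑ a ∈ S, g a k l := by
      intro g S
      rw [Finset.sum_comm]
      exact Finset.sum_congr rfl fun k _ => Finset.sum_comm
    simp only [s1]
  rw [sw]
  refine Finset.sum_congr rfl fun k _ => Finset.sum_congr rfl fun l _ => ?_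
  have e2 := alt_prod3 (fun a => (-1 : R) ^ a * (a : R) ^ k * (q ^ α) ^ a)
    (fun b => (-1 : R) ^ b * (b : R) ^ l * (q ^ β) ^ b)
    (fun c => (-1 : R) ^ c * (c : R) ^ (n - k - l) * (q ^ γ) ^ c) A B C
  trans ((n.choose k : R) * ((n - k).choose l : R) * (α : R) ^ k * (β : R) ^ l *
    (γ : R) ^ (n - k - l)) * (∑ a ∈ Finset.range A, ∑ b ∈ Finset.range B, ∑ c ∈ Finset.range C,
      (-1 : R) ^ a * (a : R) ^ k * (q ^ α) ^ a * ((-1 : R) ^ b * (b : R) ^ l * (q ^ β) ^ b) *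
      ((-1 : R) ^ c * (c : R) ^ (n - k - l) * (q ^ γ) ^ c))
  · rw [← e2]; ring
  simp only [Finset.mul_sum]
  refine Finset.sum_congr rfl fun a _ => Finset.sum_congr rfl fun b _ =>
    Finset.sum_congr rfl fun c _ => ?_
  generalize n - k - l = m
  ring

open Polynomial in
theorem alt_ne (α : ℕ) : (1 + X ^ α : ℤ[X]) ≠ 0 := by
  intro h
  have := congrArg (Polynomial.eval 1) h
  simp at this

/-- Theorem 17 (identities (60)-(61)). -/
theorem altPowSum_symmetry_triple {R : Type*} [CommRing R] (q : R)
    (n : ℕ) (w₁ w₂ w₃ : ℕ) (hw₁ : 0 < w₁) (hw₂ : 0 < w₂) (hw₃ : 0 < w₃)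
    (hw₁odd : Odd w₁) (hw₂odd : Odd w₂) (hw₃odd : Odd w₃) :
    ∑ k ∈ Finset.range (n + 1), ∑ l ∈ Finset.range (n + 1 - k),
        (n.choose k : R) * ((n - k).choose l : R) *
          altPowSum (q ^ w₃) k (w₁ - 1) * altPowSum (q ^ w₁) l (w₂ - 1) *
          altPowSum (q ^ w₂) (n - k - l) (w₃ - 1) *
          (w₃ : R) ^ k * (w₁ : R) ^ l * (w₂ : R) ^ (n - k - l)
      = ∑ k ∈ Finset.range (n + 1), ∑ l ∈ Finset.range (n + 1 - k),
        (n.choose k : R) * ((n - k).choose l : R) *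
          altPowSum (q ^ w₂) k (w₁ - 1) * altPowSum (q ^ w₁) l (w₃ - 1) *
          altPowSum (q ^ w₃) (n - k - l) (w₂ - 1) *
          (w₂ : R) ^ k * (w₁ : R) ^ l * (w₃ : R) ^ (n - k - l) := by
  rw [alt_expand q n w₃ w₁ w₂ w₁ w₂ w₃ hw₁ hw₂ hw₃,
    alt_expand q n w₂ w₁ w₃ w₁ w₃ w₂ hw₁ hw₃ hw₂]
  congr 1
  have a1 := altPoly_mul w₃ w₁ hw₁odd
  have a2 := altPoly_mul w₁ w₂ hw₂odd
  have a3 := altPoly_mul w₂ w₃ hw₃odd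
  have b1 := altPoly_mul w₂ w₁ hw₁odd
  have b2 := altPoly_mul w₁ w₃ hw₃odd
  have b3 := altPoly_mul w₃ w₂ hw₂odd
  rw [mul_comm w₃ w₁, ← b2] at a1
  rw [mul_comm w₁ w₂, ← b1] at a2
  rw [mul_comm w₂ w₃, ← b3] at a3
  apply mul_left_cancel₀ (mul_ne_zero (mul_ne_zero (alt_ne w₃) (alt_ne w₁)) (alt_ne w₂))
  calc _ = ((1 + Polynomial.X ^ w₃) * altPoly w₃ w₁) * ((1 + Polynomial.X ^ w₁) * altPoly w₁ w₂) *
        ((1 + Polynomial.X ^ w₂) * altPoly w₂ w₃) := by ring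
    _ = _ := by rw [a1, a2, a3]; ring
end

section
/- Let w₁, w₂ be any odd positive integers and let n ∈ ℕ. Then ∑_{k=0}^{n} (n choose k) T_{k,q^{w₁}}(w₂−1) T_{n−k,q}(w₁−1) w₁^{k} = ∑_{k=0}^{n} (n choose k) T_{k,q^{w₂}}(w₁−1) T_{n−k,q}(w₂−1) w₂^{k}. -/
theorem aux_range_mul {R : Type*} [CommRing R] (f : ℕ → R) (a b : ℕ) :
    ∑ i ∈ Finset.range a, ∑ j ∈ Finset.range b, f (b * i + j)
      = ∑ m ∈ Finset.range (b * a), f m := by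
  induction a with
  | zero => simp
  | succ a ih => rw [Finset.sum_range_succ, ih, Nat.mul_succ, Finset.sum_range_add]

theorem aux_side {R : Type*} [CommRing R] (q : R)
    (n : ℕ) (a b : ℕ) (ha : 0 < a) (hb : 0 < b) (hodd : Odd a) :
    ∑ k ∈ Finset.range (n + 1),
        (n.choose k : R) * altPowSum (q ^ a) k (b - 1) *
          altPowSum q (n - k) (a - 1) * (a : R) ^ k
      = ∑ m ∈ Finset.range (a * b), (-1 : R) ^ m * (m : R) ^ n * q ^ m := by
  rw [← aux_range_mul (fun m => (-1 : R) ^ m * (m : R) ^ n * q ^ m) b a]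
  unfold altPowSum
  rw [Nat.sub_add_cancel ha, Nat.sub_add_cancel hb]
  simp only [Finset.mul_sum, Finset.sum_mul]
  rw [Finset.sum_congr rfl (fun k _ => Finset.sum_comm), Finset.sum_comm]
  refine Finset.sum_congr rfl fun i _ => ?_
  rw [Finset.sum_comm]
  refine Finset.sum_congr rfl fun j _ => ?_
  push_cast
  rw [add_pow ((a : R) * i) (j : R) n, Finset.mul_sum, Finset.sum_mul]
  refine Finset.sum_congr rfl fun k _ => ?_
  rw [pow_add (-1 : R), pow_mul (-1 : R), hodd.neg_one_pow, pow_add q, pow_mul q, mul_pow]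
  ring

/-- Corollary 18. -/
theorem altPowSum_symmetry_two_var {R : Type*} [CommRing R] (q : R)
    (n : ℕ) (w₁ w₂ : ℕ) (hw₁ : 0 < w₁) (hw₂ : 0 < w₂)
    (hw₁odd : Odd w₁) (hw₂odd : Odd w₂) :
    ∑ k ∈ Finset.range (n + 1),
        (n.choose k : R) * altPowSum (q ^ w₁) k (w₂ - 1) *
          altPowSum q (n - k) (w₁ - 1) * (w₁ : R) ^ k
      = ∑ k ∈ Finset.range (n + 1),
        (n.choose k : R) * altPowSum (q ^ w₂) k (w₁ - 1) *
          altPowSum q (n - k) (w₂ - 1) * (w₂ : R) ^ k := by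
  rw [aux_side q n w₁ w₂ hw₁ hw₂ hw₁odd, aux_side q n w₂ w₁ hw₂ hw₁ hw₂odd, Nat.mul_comm]
end
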